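/- The clipped Advantage Learning operator is optimality-preserving: for every Q_0 : S × A → ℝ, defining Q_{k+1} = T_clip Q_k and V_k(s) = max_a Q_k(s,a), the sequence V_k(s) converges to V*(s) for every state s; moreover for every (s,a) with Q*(s,a) < V*(s), limsup_{k→∞} Q_k(s,a) < V*(s). -/

import Mathlib

open Filter Topology Finset

/-- Value function induced by a Q-function: `V_Q(s) = max_a Q(s,a)`. -/
noncomputable def Vof {S A : Type*} [Fintype A] [Nonempty A]
    (Q : S → A → ℝ) (s : S) : ℝ := ⨆ a, Q s a

/-- Bellman optimality operator `(T Q)(s,a) = r(s,a) + γ Σ_{s'} P(s'|s,a) V_Q(s')`. -/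
noncomputable def bellmanOp {S A : Type*} [Fintype S] [Fintype A] [Nonempty A]
    (P : S → A → S → ℝ) (r : S → A → ℝ) (γ : ℝ)
    (Q : S → A → ℝ) : S → A → ℝ :=
  fun s a => r s a + γ * ∑ s', P s a s' * Vof Q s'

/-- Advantage Learning operator `(T_AL Q)(s,a) = (T Q)(s,a) - α (V_Q(s) - Q(s,a))`. -/
noncomputable def alOp {S A : Type*} [Fintype S] [Fintype A] [Nonempty A]
    (P : S → A → S → ℝ) (r : S → A → ℝ) (γ α : ℝ)
    (Q : S → A → ℝ) : S → A → ℝ :=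
  fun s a => bellmanOp P r γ Q s a - α * (Vof Q s - Q s a)

/-- Clipped Advantage Learning operator. -/
noncomputable def clipOp {S A : Type*} [Fintype S] [Fintype A] [Nonempty A]
    (P : S → A → S → ℝ) (r : S → A → ℝ) (γ α c Ql : ℝ)
    (Q : S → A → ℝ) : S → A → ℝ :=
  fun s a => if Q s a - Ql ≥ c * (Vof Q s - Ql)
    then alOp P r γ α Q s a else bellmanOp P r γ Q s a

/-- Sup norm over a finite nonempty domain. -/
noncomputable def supNorm {S : Type*} [Fintype S] [Nonempty S] (f : S → ℝ) : ℝ :=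
  ⨆ s, |f s|

theorem aux_le_V {S A : Type*} [Fintype A] [Nonempty A] (Q : S → A → ℝ) (s : S) (a : A) :
    Q s a ≤ Vof Q s := le_ciSup (Set.finite_range (Q s)).bddAbove a

theorem aux_V_le {S A : Type*} [Fintype A] [Nonempty A] (Q : S → A → ℝ) (s : S) (x : ℝ)
    (h : ∀ a, Q s a ≤ x) : Vof Q s ≤ x := ciSup_le h

theorem aux_V_att {S A : Type*} [Fintype A] [Nonempty A] (Q : S → A → ℝ) (s : S) :
    ∃ a, Q s a = Vof Q s := exists_eq_ciSup_of_finite (f := Q s)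

theorem aux_avg {S : Type*} [Fintype S] (p : S → ℝ) (h0 : ∀ s, 0 ≤ p s) (h1 : ∑ s, p s = 1)
    (f g : S → ℝ) (m : ℝ) (h : ∀ s, f s - g s ≤ m) :
    ∑ s, p s * f s - ∑ s, p s * g s ≤ m := by
  have : ∑ s, p s * f s - ∑ s, p s * g s ≤ ∑ s, p s * m := by
    rw [← Finset.sum_sub_distrib]
    apply Finset.sum_le_sum
    intro s _
    rw [← mul_sub]
    exact mul_le_mul_of_nonneg_left (h s) (h0 s)
  rwa [← Finset.sum_mul, h1, one_mul] at this

theorem aux_bell {S A : Type*} [Fintype S] [Fintype A] [Nonempty A]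
    (P : S → A → S → ℝ) (hP0 : ∀ s a s', 0 ≤ P s a s')
    (hP1 : ∀ s a, ∑ s', P s a s' = 1)
    (r : S → A → ℝ) (γ : ℝ) (hγ0 : 0 ≤ γ) (Q Q' : S → A → ℝ) (m : ℝ)
    (h : ∀ s, Vof Q s - Vof Q' s ≤ m) (s : S) (a : A) :
    bellmanOp P r γ Q s a - bellmanOp P r γ Q' s a ≤ γ * m := by
  have := mul_le_mul_of_nonneg_left (aux_avg (P s a) (hP0 s a) (hP1 s a) _ _ m h) hγ0
  unfold bellmanOp
  linarith

theorem aux_bd {S : Type*} [Fintype S] (f : S → ℝ) : ∃ C, 0 ≤ C ∧ ∀ s, f s ≤ C :=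
  ⟨∑ s, |f s|, Finset.sum_nonneg fun _ _ => abs_nonneg _, fun s =>
    (le_abs_self _).trans
      (Finset.single_le_sum (f := fun s => |f s|) (fun _ _ => abs_nonneg _) (Finset.mem_univ s))⟩

theorem stmt_8
    {S A : Type*} [Fintype S] [Nonempty S] [Fintype A] [Nonempty A]
    (P : S → A → S → ℝ) (hP0 : ∀ s a s', 0 ≤ P s a s')
    (hP1 : ∀ s a, ∑ s', P s a s' = 1)
    (r : S → A → ℝ) (γ : ℝ) (hγ0 : 0 ≤ γ) (hγ1 : γ < 1)
    (Qstar : S → A → ℝ) (hQstar : bellmanOp P r γ Qstar = Qstar)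
    (α : ℝ) (hα0 : 0 ≤ α) (hα1 : α < 1)
    (c : ℝ) (hc0 : 0 < c) (hc1 : c < 1) (Ql : ℝ)
    (Qseq : ℕ → S → A → ℝ)
    (hQseq : ∀ k, Qseq (k + 1) = clipOp P r γ α c Ql (Qseq k))
 :
    (∀ s : S, Tendsto (fun k => Vof (Qseq k) s) atTop (𝓝 (Vof Qstar s))) ∧
    (∀ (s : S) (a : A), Qstar s a < Vof Qstar s →
      Filter.limsup (fun k => Qseq k s a) atTop < Vof Qstar s) := by

  have hup : ∀ k s a, Qseq (k+1) s a ≤ bellmanOp P r γ (Qseq k) s a := by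
    intro k s a
    rw [hQseq]
    unfold clipOp alOp
    have := mul_nonneg hα0 (sub_nonneg.2 (aux_le_V (Qseq k) s a))
    split_ifs <;> linarith
  have hlo : ∀ k s a, bellmanOp P r γ (Qseq k) s a - α * (Vof (Qseq k) s - Qseq k s a)
      ≤ Qseq (k+1) s a := by
    intro k s a
    rw [hQseq]
    unfold clipOp alOp
    have := mul_nonneg hα0 (sub_nonneg.2 (aux_le_V (Qseq k) s a))
    split_ifs <;> linarith
  -- upper bound
  obtain ⟨D, hD0, hD⟩ := aux_bd (fun s => Vof (Qseq 0) s - Vof Qstar s)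
  have hub : ∀ k s, Vof (Qseq k) s - Vof Qstar s ≤ D * γ ^ k := by
    intro k
    induction k with
    | zero => simpa using hD
    | succ k ih =>
      intro s
      obtain ⟨a, ha⟩ := aux_V_att (Qseq (k+1)) s
      have h1 := aux_bell P hP0 hP1 r γ hγ0 _ _ _ ih s a
      rw [hQstar] at h1
      have h2 := hup k s a
      have h3 := aux_le_V Qstar s a
      rw [pow_succ]
      linarith
  -- almost monotone
  obtain ⟨C, hC0, hC⟩ := aux_bd (fun s => Vof (Qseq 0) s - Vof (Qseq 1) s)
  have hmono : ∀ k s, Vof (Qseq k) s - Vof (Qseq (k+1)) s ≤ C * γ ^ k := by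
    intro k
    induction k with
    | zero => simpa using hC
    | succ k ih =>
      intro s
      obtain ⟨a, ha⟩ := aux_V_att (Qseq (k+1)) s
      have h1 := aux_bell P hP0 hP1 r γ hγ0 _ _ _ ih s a
      have h2 := hup k s a
      have h3 := hlo (k+1) s a
      rw [ha, sub_self, mul_zero, sub_zero] at h3
      have h4 := aux_le_V (Qseq (k+1+1)) s a
      rw [pow_succ]
      linarith
  have hpow : Tendsto (fun k : ℕ => γ ^ k) atTop (𝓝 0) :=
    tendsto_pow_atTop_nhds_zero_of_lt_one hγ0 hγ1
  have h1γ : 0 < 1 - γ := by linarith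
  have hconv : ∀ s, ∃ w, Tendsto (fun k => Vof (Qseq k) s) atTop (𝓝 w) := by
    intro s
    set E := C / (1 - γ) with hE
    have hE0 : 0 ≤ E := by positivity
    have hEC : E * (1 - γ) = C := by rw [hE]; field_simp
    have hm : Monotone (fun k => Vof (Qseq k) s - E * γ ^ k) := by
      apply monotone_nat_of_le_succ
      intro k
      have := hmono k s
      rw [← hEC] at this
      simp only [pow_succ]
      linarith
    have hb : BddAbove (Set.range (fun k => Vof (Qseq k) s - E * γ ^ k)) := by
      refine ⟨Vof Qstar s + D, ?_⟩
      rintro _ ⟨k, rfl⟩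
      have h1 := hub k s
      have h2 : D * γ ^ k ≤ D := mul_le_of_le_one_right hD0 (pow_le_one₀ hγ0 hγ1.le)
      have h3 : 0 ≤ E * γ ^ k := by positivity
      simp only
      linarith
    have ht := (tendsto_atTop_ciSup hm hb).add (hpow.const_mul E)
    exact ⟨_, by simpa using ht⟩
  choose W hW using hconv
  have hWle : ∀ s, W s ≤ Vof Qstar s := by
    intro s
    have h1 := (hpow.const_mul D).const_add (Vof Qstar s)
    rw [mul_zero, add_zero] at h1
    exact le_of_tendsto_of_tendsto' (hW s) h1 fun k => by linarith [hub k s]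
  have hT : ∀ s a, Tendsto (fun k => bellmanOp P r γ (Qseq k) s a) atTop
      (𝓝 (r s a + γ * ∑ s', P s a s' * W s')) := by
    intro s a
    unfold bellmanOp
    exact ((tendsto_finsetSum _ fun s' _ => (hW s').const_mul _).const_mul γ).const_add _
  have hWge : ∀ s a, r s a + γ * ∑ s', P s a s' * W s' ≤ W s := by
    intro s a
    by_contra hcon
    push Not at hcon
    have h1 := (hT s a).sub (hW s)
    obtain ⟨δ, hδ0, hδ⟩ := exists_between (sub_pos.2 hcon)
    obtain ⟨N, hN⟩ := eventually_atTop.1 (h1.eventually (lt_mem_nhds hδ))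
    have hstep : ∀ k ≥ N, Qseq k s a + δ ≤ Qseq (k+1) s a := by
      intro k hk
      have h2 := hN k hk
      have h3 := hlo k s a
      have h4 := mul_nonneg (sub_nonneg.2 hα1.le) (sub_nonneg.2 (aux_le_V (Qseq k) s a))
      linarith
    have hgrow : ∀ n : ℕ, Qseq N s a + n * δ ≤ Qseq (N+n) s a := by
      intro n
      induction n with
      | zero => simp
      | succ n ih =>
        have := hstep (N+n) (by omega)
        push_cast
        rw [← add_assoc]
        linarith
    obtain ⟨n, hn⟩ := exists_nat_gt ((Vof Qstar s + D - Qseq N s a) / δ)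
    rw [div_lt_iff₀ hδ0] at hn
    have h5 := hgrow n
    have h6 := hub (N+n) s
    have h7 : D * γ ^ (N+n) ≤ D := mul_le_of_le_one_right hD0 (pow_le_one₀ hγ0 hγ1.le)
    have h8 := aux_le_V (Qseq (N+n)) s a
    linarith
  have hQs : ∀ s a, Qstar s a = r s a + γ * ∑ s', P s a s' * Vof Qstar s' := by
    intro s a
    conv_lhs => rw [← hQstar]
    rfl
  have hWeq : ∀ s, W s = Vof Qstar s := by
    obtain ⟨s0, hs0⟩ := Finite.exists_max (fun s => Vof Qstar s - W s)
    obtain ⟨a, ha⟩ := aux_V_att Qstar s0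
    have h1 := mul_le_mul_of_nonneg_left
      (aux_avg (P s0 a) (hP0 s0 a) (hP1 s0 a) _ _ _ hs0) hγ0
    have h2 := hWge s0 a
    have h3 := hQs s0 a
    have h4 : (1 - γ) * (Vof Qstar s0 - W s0) ≤ 0 := by linarith
    have h5 : Vof Qstar s0 - W s0 ≤ 0 := by
      by_contra hh
      push Not at hh
      linarith [mul_pos h1γ hh]
    intro s
    linarith [hs0 s, hWle s]
  refine ⟨fun s => hWeq s ▸ hW s, fun s a hlt => ?_⟩
  have hTs : Tendsto (fun k => bellmanOp P r γ (Qseq k) s a) atTop (𝓝 (Qstar s a)) := by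
    have := hT s a
    simp only [hWeq] at this
    rwa [← hQs] at this
  refine lt_of_le_of_lt ?_ hlt
  obtain ⟨B, hB⟩ := (hTs.sub ((hW s).const_mul α)).bddBelow_range
  have hB' : ∀ k, B ≤ bellmanOp P r γ (Qseq k) s a - α * Vof (Qseq k) s :=
    fun k => hB ⟨k, rfl⟩
  have h1α : 0 < 1 - α := by linarith
  have hbelow : ∀ k, min (Qseq 0 s a) (B / (1 - α)) ≤ Qseq k s a := by
    intro k
    induction k with
    | zero => exact min_le_left _ _
    | succ k ih =>
      have h1 := hlo k s a
      have h2 := hB' k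
      have h3 := mul_le_mul_of_nonneg_left ih hα0
      have h4 := mul_le_mul_of_nonneg_left (min_le_right (Qseq 0 s a) (B / (1 - α))) h1α.le
      rw [mul_div_cancel₀ _ h1α.ne'] at h4
      linarith
  rw [← limsup_nat_add _ 1, ← hTs.limsup_eq]
  apply limsup_le_limsup
  · exact Eventually.of_forall fun k => hup k s a
  · exact (isBoundedUnder_of ⟨_, fun k => hbelow (k+1)⟩ :
      IsBoundedUnder (· ≥ ·) atTop (fun k => Qseq (k+1) s a)).isCoboundedUnder_le
  · exact hTs.isBoundedUnder_le
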